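/- (Existence and comparison for the competitive system.) Suppose there exist ū, v̄, u̲, v̲ ∈ C²(Ω) ∩ C(closure of Ω), all vanishing on ∂Ω, satisfying in Ω: −Δū + λū − f = 0; −Δv̲ + λv̲ + β·max(ū,v̲) − g = 0; −Δv̄ + λv̄ − g = 0; −Δu̲ + λu̲ + α·max(u̲,v̄) − f = 0. Then there exists a solution (u,v) of the competitive system −Δu + λu + α·max(u,v) − f = 0, −Δv + λv + β·max(u,v) − g = 0 in Ω (in the viscosity sense of being both a super-sub and a sub-super solution) such that u̲ ≤ u ≤ ū and v̲ ≤ v ≤ v̄ in Ω. -/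

import Mathlib

open Filter Topology Matrix Bornology

noncomputable section

/-- Euclidean space ℝⁿ. -/
abbrev En (n : ℕ) := EuclideanSpace ℝ (Fin n)

/-- n×n real matrices (the symmetric ones model 𝒮ⁿ). -/
abbrev Symn (n : ℕ) := Matrix (Fin n) (Fin n) ℝ

/-- Loewner order: `X ≤ Y` iff `Y - X` is positive semidefinite. -/
def LoewnerLE {ι : Type*} [Fintype ι] (X Y : Matrix ι ι ℝ) : Prop := (Y - X).PosSemidef

/-- Upper semicontinuous envelope relative to Ω: f*(x) = limsup_{Ω ∋ y → x} f(y). -/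
def uEnv {n : ℕ} (Ω : Set (En n)) (f : En n → ℝ) (x : En n) : ℝ := limsup f (𝓝[Ω] x)

/-- Lower semicontinuous envelope relative to Ω: f_*(x) = liminf_{Ω ∋ y → x} f(y). -/
def lEnv {n : ℕ} (Ω : Set (En n)) (f : En n → ℝ) (x : En n) : ℝ := liminf f (𝓝[Ω] x)

/-- φ touches f from above at x (within Ω). -/
def TouchAbove {n : ℕ} (Ω : Set (En n)) (φ f : En n → ℝ) (x : En n) : Prop :=
  φ x = f x ∧ ∃ N : Set (En n), IsOpen N ∧ x ∈ N ∧ ∀ y ∈ (N ∩ Ω) \ {x}, f y < φ y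

/-- φ touches f from below at x (within Ω). -/
def TouchBelow {n : ℕ} (Ω : Set (En n)) (φ f : En n → ℝ) (x : En n) : Prop :=
  φ x = f x ∧ ∃ N : Set (En n), IsOpen N ∧ x ∈ N ∧ ∀ y ∈ (N ∩ Ω) \ {x}, φ y < f y

/-- Hessian matrix D²φ(x) of a scalar function. -/
def hess {n : ℕ} (φ : En n → ℝ) (x : En n) : Symn n :=
  Matrix.of fun i j =>
    iteratedFDeriv ℝ 2 φ x ![EuclideanSpace.single i 1, EuclideanSpace.single j 1]

/-- The type of the operators F_j(x, r, s, p, X). -/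
abbrev Op (n m₁ m₂ : ℕ) :=
  En n → (Fin m₁ → ℝ) → (Fin m₂ → ℝ) → En n → Symn n → ℝ

/-- Continuity of an operator on Ω × ℝ^{m₁} × ℝ^{m₂} × ℝⁿ × 𝒮ⁿ. -/
def OpContinuousOn {n m₁ m₂ : ℕ} (Ω : Set (En n)) (F : Op n m₁ m₂) : Prop :=
  ContinuousOn (fun q : En n × (Fin m₁ → ℝ) × (Fin m₂ → ℝ) × En n × Symn n =>
      F q.1 q.2.1 q.2.2.1 q.2.2.2.1 q.2.2.2.2)
    (Ω ×ˢ (Set.univ : Set ((Fin m₁ → ℝ) × (Fin m₂ → ℝ) × En n × Symn n)))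

/-- Degenerate ellipticity of an operator. -/
def DegElliptic {n m₁ m₂ : ℕ} (Ω : Set (En n)) (F : Op n m₁ m₂) : Prop :=
  ∀ x ∈ Ω, ∀ (r : Fin m₁ → ℝ) (s : Fin m₂ → ℝ) (p : En n) (X Y : Symn n),
    X.IsSymm → Y.IsSymm → LoewnerLE X Y → F x r s p Y ≤ F x r s p X

/-- Balanced quasi-monotonicity of the system (F1, F2). -/
def BalancedQM {n m₁ m₂ : ℕ} (Ω : Set (En n))
    (F1 : Fin m₁ → Op n m₁ m₂) (F2 : Fin m₂ → Op n m₁ m₂) : Prop :=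
  (∀ j, ∀ x ∈ Ω, ∀ (r : Fin m₁ → ℝ) (s σ : Fin m₂ → ℝ) (p : En n) (X : Symn n), X.IsSymm →
      (∀ i, s i ≤ σ i) → F1 j x r s p X ≤ F1 j x r σ p X) ∧
  (∀ j, ∀ x ∈ Ω, ∀ (r ρ : Fin m₁ → ℝ) (s : Fin m₂ → ℝ) (p : En n) (X : Symn n), X.IsSymm →
      (∀ i, r i ≤ ρ i) → r j = ρ j → F1 j x ρ s p X ≤ F1 j x r s p X) ∧
  (∀ j, ∀ x ∈ Ω, ∀ (r ρ : Fin m₁ → ℝ) (s : Fin m₂ → ℝ) (p : En n) (X : Symn n), X.IsSymm →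
      (∀ i, r i ≤ ρ i) → F2 j x r s p X ≤ F2 j x ρ s p X) ∧
  (∀ j, ∀ x ∈ Ω, ∀ (r : Fin m₁ → ℝ) (s σ : Fin m₂ → ℝ) (p : En n) (X : Symn n), X.IsSymm →
      (∀ i, s i ≤ σ i) → s j = σ j → F2 j x r σ p X ≤ F2 j x r s p X)

/-- Boundedness of a vector-valued function on Ω. -/
def BddOn {n m : ℕ} (Ω : Set (En n)) (u : En n → Fin m → ℝ) : Prop :=
  ∃ M : ℝ, ∀ x ∈ Ω, ∀ i, |u x i| ≤ M

/-- (u1, u2) is a super-sub solution of the system (F1, F2) in Ω. -/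
def SuperSub {n m₁ m₂ : ℕ} (Ω : Set (En n))
    (F1 : Fin m₁ → Op n m₁ m₂) (F2 : Fin m₂ → Op n m₁ m₂)
    (u1 : En n → Fin m₁ → ℝ) (u2 : En n → Fin m₂ → ℝ) : Prop :=
  BddOn Ω u1 ∧ BddOn Ω u2 ∧
  (∀ j, ∀ x ∈ Ω, ∀ φ : En n → ℝ, ContDiff ℝ 2 φ →
      TouchBelow Ω φ (lEnv Ω fun y => u1 y j) x →
      0 ≤ F1 j x (fun i => lEnv Ω (fun y => u1 y i) x) (fun i => uEnv Ω (fun y => u2 y i) x)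
            (gradient φ x) (hess φ x)) ∧
  (∀ j, ∀ x ∈ Ω, ∀ φ : En n → ℝ, ContDiff ℝ 2 φ →
      TouchAbove Ω φ (uEnv Ω fun y => u2 y j) x →
      F2 j x (fun i => lEnv Ω (fun y => u1 y i) x) (fun i => uEnv Ω (fun y => u2 y i) x)
          (gradient φ x) (hess φ x) ≤ 0)

/-- (u1, u2) is a sub-super solution of the system (F1, F2) in Ω. -/
def SubSuper {n m₁ m₂ : ℕ} (Ω : Set (En n))
    (F1 : Fin m₁ → Op n m₁ m₂) (F2 : Fin m₂ → Op n m₁ m₂)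
    (u1 : En n → Fin m₁ → ℝ) (u2 : En n → Fin m₂ → ℝ) : Prop :=
  BddOn Ω u1 ∧ BddOn Ω u2 ∧
  (∀ j, ∀ x ∈ Ω, ∀ φ : En n → ℝ, ContDiff ℝ 2 φ →
      TouchAbove Ω φ (uEnv Ω fun y => u1 y j) x →
      F1 j x (fun i => uEnv Ω (fun y => u1 y i) x) (fun i => lEnv Ω (fun y => u2 y i) x)
          (gradient φ x) (hess φ x) ≤ 0) ∧
  (∀ j, ∀ x ∈ Ω, ∀ φ : En n → ℝ, ContDiff ℝ 2 φ →
      TouchBelow Ω φ (lEnv Ω fun y => u2 y j) x →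
      0 ≤ F2 j x (fun i => uEnv Ω (fun y => u1 y i) x) (fun i => lEnv Ω (fun y => u2 y i) x)
            (gradient φ x) (hess φ x))

/-- (u, v) is a super-sub solution of the competitive system
-Δu + λu + α max(u,v) - f = 0, -Δv + λv + β max(u,v) - g = 0 in Ω. -/
def CompSuperSub {n : ℕ} (Ω : Set (En n)) (lam al be : ℝ) (f g : En n → ℝ)
    (u v : En n → ℝ) : Prop :=
  (∃ M : ℝ, ∀ x ∈ Ω, |u x| ≤ M ∧ |v x| ≤ M) ∧
  (∀ x ∈ Ω, ∀ φ : En n → ℝ, ContDiff ℝ 2 φ → TouchBelow Ω φ (lEnv Ω u) x →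
    0 ≤ -(hess φ x).trace + lam * lEnv Ω u x + al * max (lEnv Ω u x) (uEnv Ω v x) - f x) ∧
  (∀ x ∈ Ω, ∀ φ : En n → ℝ, ContDiff ℝ 2 φ → TouchAbove Ω φ (uEnv Ω v) x →
    -(hess φ x).trace + lam * uEnv Ω v x + be * max (lEnv Ω u x) (uEnv Ω v x) - g x ≤ 0)

/-- (u, v) is a sub-super solution of the competitive system
-Δu + λu + α max(u,v) - f = 0, -Δv + λv + β max(u,v) - g = 0 in Ω. -/
def CompSubSuper {n : ℕ} (Ω : Set (En n)) (lam al be : ℝ) (f g : En n → ℝ)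
    (u v : En n → ℝ) : Prop :=
  (∃ M : ℝ, ∀ x ∈ Ω, |u x| ≤ M ∧ |v x| ≤ M) ∧
  (∀ x ∈ Ω, ∀ φ : En n → ℝ, ContDiff ℝ 2 φ → TouchAbove Ω φ (uEnv Ω u) x →
    -(hess φ x).trace + lam * uEnv Ω u x + al * max (uEnv Ω u x) (lEnv Ω v x) - f x ≤ 0) ∧
  (∀ x ∈ Ω, ∀ φ : En n → ℝ, ContDiff ℝ 2 φ → TouchBelow Ω φ (lEnv Ω v) x →
    0 ≤ -(hess φ x).trace + lam * lEnv Ω v x + be * max (uEnv Ω u x) (lEnv Ω v x) - g x)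

section Laplacian

variable {n : ℕ}

theorem trace_hess_eq_laplacian (φ : En n → ℝ) :
    (fun x => (hess φ x).trace) = Laplacian.laplacian φ := by
  rw [InnerProductSpace.laplacian_eq_iteratedFDeriv_orthonormalBasis φ
    (EuclideanSpace.basisFun (Fin n) ℝ)]
  ext x
  simp [hess, Matrix.trace]

theorem trace_hess_apply (φ : En n → ℝ) (x : En n) :
    (hess φ x).trace = Laplacian.laplacian φ x :=
  congrFun (trace_hess_eq_laplacian φ) x

theorem trace_hess_neg (φ : En n → ℝ) (x : En n) :
    (hess (-φ) x).trace = -(hess φ x).trace := by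
  simp [trace_hess_apply, InnerProductSpace.laplacian_neg]

theorem trace_hess_sub {φ ψ : En n → ℝ} {x : En n} (hφ : ContDiffAt ℝ 2 φ x)
    (hψ : ContDiffAt ℝ 2 ψ x) :
    (hess (φ - ψ) x).trace = (hess φ x).trace - (hess ψ x).trace := by
  simp [trace_hess_apply, hφ.laplacian_sub hψ]

theorem trace_hess_add {φ ψ : En n → ℝ} {x : En n} (hφ : ContDiffAt ℝ 2 φ x)
    (hψ : ContDiffAt ℝ 2 ψ x) :
    (hess (φ + ψ) x).trace = (hess φ x).trace + (hess ψ x).trace := by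
  simp [trace_hess_apply, hφ.laplacian_add hψ]

theorem trace_hess_smul {φ : En n → ℝ} {x : En n} (c : ℝ) (hφ : ContDiffAt ℝ 2 φ x) :
    (hess (c • φ) x).trace = c * (hess φ x).trace := by
  simp [trace_hess_apply, InnerProductSpace.laplacian_smul c hφ]

theorem trace_hess_const (c : ℝ) (x : En n) : (hess (fun _ => c) x).trace = 0 := by
  simp [trace_hess_apply]

theorem trace_hess_add_const {φ : En n → ℝ} {x : En n} (hφ : ContDiffAt ℝ 2 φ x) (c : ℝ) :
    (hess (fun y => φ y + c) x).trace = (hess φ x).trace := by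
  have h := trace_hess_add hφ (contDiffAt_const (c := c))
  rw [trace_hess_const, add_zero] at h
  exact h

theorem continuous_trace_hess {φ : En n → ℝ} (hφ : ContDiff ℝ 2 φ) :
    Continuous fun x => (hess φ x).trace := by
  have h : Continuous (iteratedFDeriv ℝ 2 φ) := hφ.continuous_iteratedFDeriv le_rfl
  simp only [hess, Matrix.trace, Matrix.diag, Matrix.of_apply]
  exact continuous_finsetSum _ fun i _ => (ContinuousMultilinearMap.apply ℝ (fun _ : Fin 2 => En n) ℝ
    ![EuclideanSpace.single i 1, EuclideanSpace.single i 1]).continuous.comp h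

/-- The second derivative of a real function is nonpositive at a local maximum. -/
theorem IsLocalMax.deriv_deriv_nonpos {h : ℝ → ℝ} {a : ℝ} (hm : IsLocalMax h a)
    (hc : ContinuousAt h a) : deriv (deriv h) a ≤ 0 := by
  by_contra! hpos
  have hmin := isLocalMin_of_deriv_deriv_pos hpos hm.deriv_eq_zero hc
  have hconst : h =ᶠ[𝓝 a] fun _ => h a := by
    filter_upwards [hm, hmin] with t h1 h2 using le_antisymm h1 h2
  have hd : deriv h =ᶠ[𝓝 a] fun _ => (0 : ℝ) := by
    simpa using hconst.deriv
  rw [hd.deriv_eq] at hpos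
  simp at hpos

theorem IsLocalMax.iteratedFDeriv_two_nonpos {E : Type*} [NormedAddCommGroup E] [NormedSpace ℝ E]
    {h : E → ℝ} {x : E} (hm : IsLocalMax h x)
    (hh : ContDiffAt ℝ 2 h x) (e : E) : iteratedFDeriv ℝ 2 h x ![e, e] ≤ 0 := by
  let l : ℝ → E := fun t => x + t • e
  have hl0 : l 0 = x := by simp [l]
  have hl : ∀ t, HasDerivAt l e t := fun t => by
    simpa [l] using ((hasDerivAt_id' t).smul_const e).const_add x
  have hlc : ContinuousAt l 0 := (hl 0).continuousAt
  have hlt : Tendsto l (𝓝 0) (𝓝 x) := by simpa [ContinuousAt, hl0] using hlc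
  have hev : ∀ᶠ y in 𝓝 x, DifferentiableAt ℝ h y := by
    filter_upwards [hh.eventually (by simp)] with y hy using hy.differentiableAt (by simp)
  have hd1 : deriv (fun t => h (l t)) =ᶠ[𝓝 0] fun t => fderiv ℝ h (l t) e := by
    filter_upwards [hlt.eventually hev] with t ht
    exact (ht.hasFDerivAt.comp_hasDerivAt t (hl t)).deriv
  have hd2 : deriv (deriv fun t => h (l t)) 0 = fderiv ℝ (fderiv ℝ h) x e e := by
    rw [hd1.deriv_eq]
    have hf : DifferentiableAt ℝ (fderiv ℝ h) (l 0) := by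
      rw [hl0]
      exact (hh.fderiv_right (m := 1) (by norm_num)).differentiableAt (by simp)
    have h1 := hf.hasFDerivAt.comp_hasDerivAt 0 (hl 0)
    have h2 := (h1.clm_apply (hasDerivAt_const 0 e)).deriv
    simpa [hl0] using h2
  have hm' : IsLocalMax (fun t => h (l t)) 0 := by
    have := hlt.eventually hm
    filter_upwards [this] with t ht
    simpa [hl0] using ht
  have := hm'.deriv_deriv_nonpos (ContinuousAt.comp (by rw [hl0]; exact hh.continuousAt) hlc)
  rw [hd2] at this
  simpa [iteratedFDeriv_two_apply] using this

theorem IsLocalMax.trace_hess_nonpos {h : En n → ℝ} {x : En n} (hm : IsLocalMax h x)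
    (hh : ContDiffAt ℝ 2 h x) : (hess h x).trace ≤ 0 :=
  Finset.sum_nonpos fun i _ => hm.iteratedFDeriv_two_nonpos hh (EuclideanSpace.single i 1)

theorem IsLocalMax.trace_hess_le {φ ψ : En n → ℝ} {x : En n}
    (hm : IsLocalMax (fun y => φ y - ψ y) x)
    (hφ : ContDiffAt ℝ 2 φ x) (hψ : ContDiffAt ℝ 2 ψ x) :
    (hess φ x).trace ≤ (hess ψ x).trace := by
  have := IsLocalMax.trace_hess_nonpos (h := φ - ψ) hm (hφ.sub hψ)
  rw [trace_hess_sub hφ hψ] at this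
  linarith

/-- A bound on the Laplacian of a test function at a touching point need only be checked for
test functions touching with a quadratic gap. -/
theorem IsLocalMax.le_trace_hess_of_quadratic {w φ : En n → ℝ} {x : En n} {c : ℝ}
    (hφ : ContDiff ℝ 2 φ) (hm : IsLocalMax (fun y => w y - φ y) x)
    (H : ∀ ψ : En n → ℝ, ContDiff ℝ 2 ψ → ψ x = w x →
      ∀ ε > 0, (∀ᶠ y in 𝓝 x, w y + ε * dist y x ^ 2 ≤ ψ y) → c ≤ (hess ψ x).trace) :
    c ≤ (hess φ x).trace := by
  let q : En n → ℝ := fun y => ‖y - x‖ ^ 2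
  have hq : ContDiff ℝ 2 q := (contDiff_id.sub contDiff_const).norm_sq ℝ
  have key : ∀ ε > 0, c ≤ (hess φ x).trace + ε * (hess q x).trace := by
    intro ε hε
    have hεq : ContDiff ℝ 2 (ε • q) := hq.const_smul ε
    have hs : ContDiff ℝ 2 (φ + ε • q) := hφ.add hεq
    let d : En n → ℝ := fun _ => w x - φ x
    have hd : ContDiff ℝ 2 d := contDiff_const
    have := H ((φ + ε • q) + d) (hs.add hd)
      (by simp [q, d]) ε hε (by
        filter_upwards [hm] with y hy
        simp only [Pi.add_apply, Pi.smul_apply, smul_eq_mul, q, d, dist_eq_norm]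
        linarith)
    rwa [trace_hess_add hs.contDiffAt hd.contDiffAt,
      trace_hess_add hφ.contDiffAt hεq.contDiffAt,
      trace_hess_smul ε hq.contDiffAt, trace_hess_const, add_zero] at this
  have hlim : Tendsto (fun ε : ℝ => (hess φ x).trace + ε * (hess q x).trace) (𝓝[>] 0)
      (𝓝 ((hess φ x).trace)) := by
    have : Continuous fun ε : ℝ => (hess φ x).trace + ε * (hess q x).trace := by fun_prop
    simpa using (this.tendsto 0).mono_left nhdsWithin_le_nhds
  exact ge_of_tendsto hlim (by filter_upwards [self_mem_nhdsWithin] with ε hε using key ε hε)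

theorem IsLocalMin.trace_hess_le_of_quadratic {w φ : En n → ℝ} {x : En n} {c : ℝ}
    (hφ : ContDiff ℝ 2 φ) (hm : IsLocalMin (fun y => w y - φ y) x)
    (H : ∀ ψ : En n → ℝ, ContDiff ℝ 2 ψ → ψ x = w x →
      ∀ ε > 0, (∀ᶠ y in 𝓝 x, ψ y + ε * dist y x ^ 2 ≤ w y) → (hess ψ x).trace ≤ c) :
    (hess φ x).trace ≤ c := by
  have hm' : IsLocalMax (fun y => (-w) y - (-φ) y) x := by
    filter_upwards [hm] with y hy
    simp only [Pi.neg_apply]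
    linarith
  have hφ' : ContDiff ℝ 2 (-φ) := hφ.neg
  have := hm'.le_trace_hess_of_quadratic (c := -c) hφ' fun ψ hψ hψx ε hε hy => by
    have := H (-ψ) hψ.neg (by simp [hψx]) ε hε (by
      filter_upwards [hy] with y hy
      simp only [Pi.neg_apply] at hy ⊢
      linarith)
    rw [trace_hess_neg] at this
    linarith
  rw [trace_hess_neg] at this
  linarith

end Laplacian

section Envelope

variable {n : ℕ} {Ω : Set (En n)} {f g : En n → ℝ} {x : En n} {B c : ℝ}

theorem lEnv_eq_neg_uEnv (Ω : Set (En n)) (f : En n → ℝ) (x : En n) :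
    lEnv Ω f x = -uEnv Ω (-f) x := by
  simp only [lEnv, uEnv, Filter.limsup_eq, Filter.liminf_eq, Real.sInf_def]
  rw [neg_neg]
  congr 1
  ext a
  simp

theorem isBoundedUnder_le_of_abs_le (hB : ∀ y ∈ Ω, |f y| ≤ B) (x : En n) :
    IsBoundedUnder (· ≤ ·) (𝓝[Ω] x) f :=
  isBoundedUnder_of_eventually_le (a := B)
    (by filter_upwards [self_mem_nhdsWithin] with y hy using (abs_le.1 (hB y hy)).2)

theorem isBoundedUnder_ge_of_abs_le (hB : ∀ y ∈ Ω, |f y| ≤ B) (x : En n) :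
    IsBoundedUnder (· ≥ ·) (𝓝[Ω] x) f :=
  isBoundedUnder_of_eventually_ge (a := -B)
    (by filter_upwards [self_mem_nhdsWithin] with y hy using (abs_le.1 (hB y hy)).1)

theorem neBot_nhdsWithin_of_mem (hx : x ∈ Ω) : (𝓝[Ω] x).NeBot :=
  mem_closure_iff_nhdsWithin_neBot.1 (subset_closure hx)

theorem uEnv_mono (hf : ∀ y ∈ Ω, |f y| ≤ B) (hg : ∀ y ∈ Ω, |g y| ≤ B) (hx : x ∈ Ω)
    (h : ∀ᶠ y in 𝓝[Ω] x, f y ≤ g y) : uEnv Ω f x ≤ uEnv Ω g x := by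
  have := neBot_nhdsWithin_of_mem hx
  exact limsup_le_limsup h (isBoundedUnder_ge_of_abs_le hf x).isCoboundedUnder_le
    (isBoundedUnder_le_of_abs_le hg x)

theorem uEnv_le (hf : ∀ y ∈ Ω, |f y| ≤ B) (hx : x ∈ Ω)
    (h : ∀ᶠ y in 𝓝[Ω] x, f y ≤ c) : uEnv Ω f x ≤ c := by
  have := neBot_nhdsWithin_of_mem hx
  exact limsup_le_of_le (isBoundedUnder_ge_of_abs_le hf x).isCoboundedUnder_le h

theorem eventually_lt_of_uEnv_lt (hf : ∀ y ∈ Ω, |f y| ≤ B) (h : uEnv Ω f x < c) :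
    ∀ᶠ y in 𝓝[Ω] x, f y < c :=
  eventually_lt_of_limsup_lt h (isBoundedUnder_le_of_abs_le hf x)

theorem le_uEnv (hf : ∀ y ∈ Ω, |f y| ≤ B) (hx : x ∈ Ω) : f x ≤ uEnv Ω f x := by
  refine le_of_forall_gt fun c hc => ?_
  exact (eventually_lt_of_uEnv_lt hf hc).self_of_nhdsWithin hx

theorem frequently_lt_of_lt_uEnv (hf : ∀ y ∈ Ω, |f y| ≤ B) (hx : x ∈ Ω) (h : c < uEnv Ω f x) :
    ∃ᶠ y in 𝓝[Ω] x, c < f y := by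
  have := neBot_nhdsWithin_of_mem hx
  exact frequently_lt_of_lt_limsup (isBoundedUnder_ge_of_abs_le hf x).isCoboundedUnder_le h

theorem eventually_uEnv_lt (hΩ : IsOpen Ω) (hf : ∀ y ∈ Ω, |f y| ≤ B) (hx : x ∈ Ω)
    (h : uEnv Ω f x < c) : ∀ᶠ y in 𝓝 x, uEnv Ω f y < c := by
  obtain ⟨d, hd, hdc⟩ := exists_between h
  have h1 := eventually_lt_of_uEnv_lt hf hd
  rw [hΩ.nhdsWithin_eq hx] at h1
  filter_upwards [h1.eventually_nhds, hΩ.mem_nhds hx] with y hy hyΩ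
  refine (uEnv_le hf hyΩ ?_).trans_lt hdc
  rw [hΩ.nhdsWithin_eq hyΩ]
  filter_upwards [hy] with z hz using hz.le

theorem abs_neg_apply_le (hf : ∀ y ∈ Ω, |f y| ≤ B) : ∀ y ∈ Ω, |(-f) y| ≤ B := by
  simpa using hf

theorem lEnv_le (hf : ∀ y ∈ Ω, |f y| ≤ B) (hx : x ∈ Ω) : lEnv Ω f x ≤ f x := by
  have := le_uEnv (abs_neg_apply_le hf) hx
  rw [lEnv_eq_neg_uEnv]
  simp only [Pi.neg_apply] at this
  linarith

theorem lEnv_mono (hf : ∀ y ∈ Ω, |f y| ≤ B) (hg : ∀ y ∈ Ω, |g y| ≤ B) (hx : x ∈ Ω)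
    (h : ∀ᶠ y in 𝓝[Ω] x, f y ≤ g y) : lEnv Ω f x ≤ lEnv Ω g x := by
  rw [lEnv_eq_neg_uEnv, lEnv_eq_neg_uEnv, neg_le_neg_iff]
  refine uEnv_mono (abs_neg_apply_le hg) (abs_neg_apply_le hf) hx ?_
  filter_upwards [h] with y hy using neg_le_neg hy

theorem frequently_lt_of_lEnv_lt (hf : ∀ y ∈ Ω, |f y| ≤ B) (hx : x ∈ Ω) (h : lEnv Ω f x < c) :
    ∃ᶠ y in 𝓝[Ω] x, f y < c := by
  rw [lEnv_eq_neg_uEnv] at h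
  refine (frequently_lt_of_lt_uEnv (abs_neg_apply_le hf) hx (neg_lt.1 h)).mono fun y hy => ?_
  exact neg_lt_neg_iff.1 hy

theorem eventually_lt_lEnv (hΩ : IsOpen Ω) (hf : ∀ y ∈ Ω, |f y| ≤ B) (hx : x ∈ Ω)
    (h : c < lEnv Ω f x) : ∀ᶠ y in 𝓝 x, c < lEnv Ω f y := by
  rw [lEnv_eq_neg_uEnv] at h
  filter_upwards [eventually_uEnv_lt hΩ (abs_neg_apply_le hf) hx (lt_neg.1 h)] with y hy
  rw [lEnv_eq_neg_uEnv]
  exact lt_neg.1 hy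

theorem uEnv_eq_of_continuousAt (hx : x ∈ Ω) (h : ContinuousAt f x) : uEnv Ω f x = f x := by
  have := neBot_nhdsWithin_of_mem hx
  exact (h.tendsto.mono_left nhdsWithin_le_nhds).limsup_eq

theorem lEnv_eq_of_continuousAt (hx : x ∈ Ω) (h : ContinuousAt f x) : lEnv Ω f x = f x := by
  have := neBot_nhdsWithin_of_mem hx
  exact (h.tendsto.mono_left nhdsWithin_le_nhds).liminf_eq

end Envelope

section Perron

open Set

variable {n : ℕ} {ι : Type*}

/-- Viscosity subsolutions of the system `-Δ U k + G k x U = 0`. -/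
def IsViscositySub (Ω : Set (En n)) (G : ι → En n → (ι → ℝ) → ℝ) (U : ι → En n → ℝ) : Prop :=
  ∀ k, ∀ x ∈ Ω, ∀ φ : En n → ℝ, ContDiff ℝ 2 φ →
    IsLocalMax (fun y => uEnv Ω (U k) y - φ y) x →
      G k x (fun j => uEnv Ω (U j) x) ≤ (hess φ x).trace

/-- Viscosity supersolutions of the system `-Δ U k + G k x U = 0`. -/
def IsViscositySuper (Ω : Set (En n)) (G : ι → En n → (ι → ℝ) → ℝ) (U : ι → En n → ℝ) : Prop :=
  ∀ k, ∀ x ∈ Ω, ∀ φ : En n → ℝ, ContDiff ℝ 2 φ →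
    IsLocalMin (fun y => lEnv Ω (U k) y - φ y) x →
      (hess φ x).trace ≤ G k x (fun j => lEnv Ω (U j) x)

/-- Quasi-monotonicity: `G k` is nonincreasing in the components other than the `k`-th. -/
def IsCooperative (Ω : Set (En n)) (G : ι → En n → (ι → ℝ) → ℝ) : Prop :=
  ∀ k, ∀ x ∈ Ω, ∀ r s : ι → ℝ, r ≤ s → r k = s k → G k x s ≤ G k x r

variable {Ω : Set (En n)} {G : ι → En n → (ι → ℝ) → ℝ} {B : ℝ}

theorem exists_pos_forall_lt [Fintype ι] {F : En n → (ι → ℝ) → ℝ} {T : En n → ℝ} {x : En n} {a : ι → ℝ}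
    (hΩ : IsOpen Ω) (hx : x ∈ Ω)
    (hF : ContinuousOn (fun p : En n × (ι → ℝ) => F p.1 p.2) (Ω ×ˢ univ))
    (hT : Continuous T) (h : T x < F x a) :
    ∃ η > 0, ∀ z, dist z x < η → z ∈ Ω ∧ ∀ s : ι → ℝ, (∀ j, |s j - a j| < η) → T z < F z s := by
  have hmem : (Ω ×ˢ univ : Set (En n × (ι → ℝ))) ∈ 𝓝 (x, a) :=
    (hΩ.prod isOpen_univ).mem_nhds ⟨hx, mem_univ _⟩
  have hFa : ContinuousAt (fun p : En n × (ι → ℝ) => F p.1 p.2) (x, a) := hF.continuousAt hmem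
  have hTa : ContinuousAt (fun p : En n × (ι → ℝ) => T p.1) (x, a) :=
    (hT.comp continuous_fst).continuousAt
  obtain ⟨η, hη, hball⟩ := Metric.eventually_nhds_iff.1 ((hTa.eventually_lt hFa h).and hmem)
  refine ⟨η, hη, fun z hz => ⟨(hball (y := (z, a)) ?_).2.1, fun s hs => (hball (y := (z, s)) ?_).1⟩⟩
  · simpa [Prod.dist_eq, hη] using hz
  · rw [Prod.dist_eq, max_lt_iff]
    exact ⟨hz, (dist_pi_lt_iff hη).2 fun j => by simpa [Real.dist_eq] using hs j⟩

/-- A function approximated pointwise from below by the subsolutions lying below it is a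
subsolution. -/
theorem isViscositySub_of_forall_exists [Fintype ι] [DecidableEq ι] (hΩ : IsOpen Ω)
    (hG : ∀ k, ContinuousOn (fun p : En n × (ι → ℝ) => G k p.1 p.2) (Ω ×ˢ univ))
    (hGm : IsCooperative Ω G) {U : ι → En n → ℝ} (hU : ∀ k, ∀ x ∈ Ω, |U k x| ≤ B)
    (H : ∀ k, ∀ x ∈ Ω, ∀ c < U k x, ∃ W : ι → En n → ℝ, IsViscositySub Ω G W ∧
      (∀ j, ∀ y ∈ Ω, |W j y| ≤ B) ∧ (∀ j, ∀ y ∈ Ω, W j y ≤ U j y) ∧ c < W k x) :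
    IsViscositySub Ω G U := by
  intro k x hx φ hφ hmax
  refine hmax.le_trace_hess_of_quadratic hφ fun ψ hψ hψx ε hε htouch => ?_
  by_contra! hlt
  obtain ⟨η, hη, hbox⟩ :=
    exists_pos_forall_lt hΩ hx (hG k) (continuous_trace_hess hψ) hlt
  have hev1 : ∀ᶠ y in 𝓝 x, ∀ j, uEnv Ω (U j) y < uEnv Ω (U j) x + η / 2 :=
    eventually_all.2 fun j => eventually_uEnv_lt hΩ (hU j) hx (by linarith)
  have hev2 : ∀ᶠ y in 𝓝 x, |ψ y - ψ x| < η / 4 :=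
    Metric.tendsto_nhds.1 hψ.continuous.continuousAt (η / 4) (by positivity)
  obtain ⟨r, hr, hball⟩ := Metric.eventually_nhds_iff.1 (htouch.and (hev1.and hev2))
  set ρ := min (r / 2) (η / 2) with hρdef
  have hρ : 0 < ρ := by positivity
  have hρr : ρ < r := (min_le_left _ _).trans_lt (by linarith)
  have hρη : ρ < η := (min_le_right _ _).trans_lt (by linarith)
  set δ := min (ε * ρ ^ 2) (η / 4) with hδdef
  have hδ : 0 < δ := by positivity
  have hΩρ : ∀ z ∈ Metric.closedBall x ρ, z ∈ Ω := fun z hz =>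
    (hbox z ((Metric.mem_closedBall.1 hz).trans_lt hρη)).1
  -- a point and a subsolution nearly realizing the envelope
  obtain ⟨y, hyU, hyψ, hyρ⟩ : ∃ y, uEnv Ω (U k) x - δ / 2 < U k y ∧ ψ y - ψ x < δ / 2 ∧
      y ∈ Metric.ball x ρ := by
    have h1 := frequently_lt_of_lt_uEnv (hU k) hx (show uEnv Ω (U k) x - δ / 2 < _ by linarith)
    have h2 : ∀ᶠ y in 𝓝[Ω] x, ψ y < ψ x + δ / 2 ∧ y ∈ Metric.ball x ρ :=
      nhdsWithin_le_nhds ((hψ.continuous.continuousAt.eventually_lt continuousAt_const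
        (by linarith)).and (Metric.ball_mem_nhds x hρ))
    obtain ⟨y, hy1, hy2, hy3⟩ := (h1.and_eventually h2).exists
    exact ⟨y, hy1, by linarith, hy3⟩
  have hyΩ := hΩρ y (Metric.ball_subset_closedBall hyρ)
  obtain ⟨W, hWsub, hWB, hWU, hWy⟩ := H k y hyΩ _ hyU
  have hWUenv : ∀ j, ∀ z ∈ Ω, uEnv Ω (W j) z ≤ uEnv Ω (U j) z := fun j z hz =>
    uEnv_mono (hWB j) (hU j) hz (by filter_upwards [self_mem_nhdsWithin] with t ht using hWU j t ht)
  -- maximize `W* - ψ` over the closed ball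
  have husc : UpperSemicontinuousOn (fun z => uEnv Ω (W k) z - ψ z) (Metric.closedBall x ρ) := by
    have h1 : UpperSemicontinuousOn (uEnv Ω (W k)) (Metric.closedBall x ρ) := fun z hz c hc =>
      nhdsWithin_le_nhds (eventually_uEnv_lt hΩ (hWB k) (hΩρ z hz) hc)
    have h2 : UpperSemicontinuousOn (fun z => -ψ z) (Metric.closedBall x ρ) :=
      hψ.continuous.neg.continuousOn.upperSemicontinuousOn
    simpa [sub_eq_add_neg] using h1.add h2
  obtain ⟨z, hz, hzmax⟩ := husc.exists_isMaxOn ⟨x, Metric.mem_closedBall_self hρ.le⟩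
    (isCompact_closedBall x ρ)
  have hzy : uEnv Ω (W k) y - ψ y ≤ uEnv Ω (W k) z - ψ z :=
    hzmax (Metric.ball_subset_closedBall hyρ)
  have hWyenv := le_uEnv (hWB k) hyΩ
  have hzδ : -δ < uEnv Ω (W k) z - ψ z := by linarith
  have hzΩ := hΩρ z hz
  obtain ⟨hztouch, hzenv, hzψ⟩ := hball ((Metric.mem_closedBall.1 hz).trans_lt hρr)
  have hzUW := hWUenv k z hzΩ
  have hzball : z ∈ Metric.ball x ρ := by
    rw [Metric.mem_ball]
    by_contra! hge
    have : ε * ρ ^ 2 ≤ ε * dist z x ^ 2 := by gcongr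
    have := min_le_left (ε * ρ ^ 2) (η / 4)
    linarith
  have hzloc : IsLocalMax (fun z => uEnv Ω (W k) z - ψ z) z :=
    hzmax.isLocalMax (mem_of_superset (Metric.isOpen_ball.mem_nhds hzball)
      Metric.ball_subset_closedBall)
  have hsub := hWsub k z hzΩ ψ hψ hzloc
  let s : ι → ℝ := Function.update (fun j => uEnv Ω (U j) x + η / 2) k (uEnv Ω (W k) z)
  have hsk : s k = uEnv Ω (W k) z := by simp [s]
  have hsj : ∀ j, j ≠ k → s j = uEnv Ω (U j) x + η / 2 := fun j hj => by simp [s, hj]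
  have hmono := hGm k z hzΩ (fun j => uEnv Ω (W j) z) s (fun j => by
    by_cases hj : j = k
    · subst hj; exact hsk.ge
    · rw [hsj j hj]; exact (hWUenv j z hzΩ).trans (hzenv j).le) hsk.symm
  have hstrict := (hbox z ((Metric.mem_closedBall.1 hz).trans_lt hρη)).2 s (fun j => by
    by_cases hj : j = k
    · subst hj
      rw [hsk, abs_lt]
      have := abs_lt.1 hzψ
      have := min_le_right (ε * ρ ^ 2) (η / 4)
      have : 0 ≤ ε * dist z x ^ 2 := by positivity
      constructor <;> linarith
    · rw [hsj j hj, add_sub_cancel_left, abs_of_pos (by positivity)]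
      linarith)
  linarith

/-- Raising one component of a subsolution to a strict classical subsolution near a point gives
a subsolution. -/
theorem IsViscositySub.bump (hΩ : IsOpen Ω) (hGm : IsCooperative Ω G)
    {U W : ι → En n → ℝ} (hUsub : IsViscositySub Ω G U)
    (hU : ∀ k, ∀ x ∈ Ω, |U k x| ≤ B) (hW : ∀ k, ∀ x ∈ Ω, |W k x| ≤ B)
    {k : ι} {x : En n} {r : ℝ} {ψ : En n → ℝ} (hψ : ContDiff ℝ 2 ψ)
    (hWj : ∀ j, j ≠ k → W j = U j)
    (hWin : ∀ y, dist y x < r → W k y = max (U k y) (ψ y))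
    (hWout : ∀ y, r ≤ dist y x → W k y = U k y)
    (hann : ∀ᵉ y ∈ Ω, r / 2 < dist y x → dist y x < r → ψ y ≤ U k y)
    (hstrict : ∀ z, dist z x < r → ∀ s : ι → ℝ, s k = ψ z → (∀ j, lEnv Ω (U j) z ≤ s j) →
      G k z s ≤ (hess ψ z).trace) :
    IsViscositySub Ω G W := by
  have hUW : ∀ j, ∀ y, U j y ≤ W j y := by
    intro j y
    by_cases hj : j = k
    · subst hj
      rcases lt_or_ge (dist y x) r with hy | hy
      · rw [hWin y hy]; exact le_max_left _ _
      · exact (hWout y hy).ge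
    · rw [hWj j hj]
  have hUWenv : ∀ j, ∀ z ∈ Ω, uEnv Ω (U j) z ≤ uEnv Ω (W j) z := fun j z hz =>
    uEnv_mono (hU j) (hW j) hz (Eventually.of_forall (hUW j))
  -- where the envelopes agree, the subsolution property is inherited from `U`
  have hinherit : ∀ j, ∀ z ∈ Ω, uEnv Ω (W j) z = uEnv Ω (U j) z → ∀ φ : En n → ℝ,
      ContDiff ℝ 2 φ → IsLocalMax (fun y => uEnv Ω (W j) y - φ y) z →
      G j z (fun i => uEnv Ω (W i) z) ≤ (hess φ z).trace := by
    intro j z hz heq φ hφ hmax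
    refine (hGm j z hz _ _ (fun i => hUWenv i z hz) heq.symm).trans (hUsub j z hz φ hφ ?_)
    filter_upwards [hmax, hΩ.mem_nhds hz] with y hy hyΩ
    have := hUWenv j y hyΩ
    rw [heq] at hy
    linarith
  intro j z hz φ hφ hmax
  by_cases hj : j = k
  swap
  · exact hinherit j z hz (by rw [hWj j hj]) φ hφ hmax
  subst hj
  rcases (hUWenv j z hz).eq_or_lt with heq | hlt
  · exact hinherit j z hz heq.symm φ hφ hmax
  have hzr : dist z x < r := by
    by_contra! hge
    refine hlt.not_ge (uEnv_mono (hW j) (hU j) hz ?_)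
    rcases le_or_gt r 0 with hr | hr
    · exact Eventually.of_forall fun y => (hWout y (hr.trans dist_nonneg)).le
    have hopen : ∀ᶠ y in 𝓝[Ω] z, r / 2 < dist y x :=
      nhdsWithin_le_nhds ((continuous_id.dist continuous_const).continuousAt.eventually_const_lt
        (show r / 2 < dist z x by linarith))
    filter_upwards [hopen, self_mem_nhdsWithin] with y hy hyΩ
    rcases lt_or_ge (dist y x) r with hyr | hyr
    · rw [hWin y hyr]; exact max_le le_rfl (hann y hyΩ hy hyr)
    · exact (hWout y hyr).le
  have hballev : ∀ᶠ y in 𝓝 z, dist y x < r :=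
    (continuous_id.dist continuous_const).continuousAt.eventually_lt_const hzr
  have hge : ∀ y ∈ Ω, dist y x < r → ψ y ≤ uEnv Ω (W j) y := fun y hy hyr =>
    ((le_max_right _ _).trans (hWin y hyr).ge).trans (le_uEnv (hW j) hy)
  have hle : uEnv Ω (W j) z ≤ ψ z := by
    by_contra! hcon
    obtain ⟨c, hc1, hc2⟩ := exists_between (max_lt hlt hcon)
    obtain ⟨hcU, hcψ⟩ := max_lt_iff.1 hc1
    refine hc2.not_ge (uEnv_le (hW j) hz ?_)
    filter_upwards [eventually_lt_of_uEnv_lt (hU j) hcU, nhdsWithin_le_nhds hballev,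
      nhdsWithin_le_nhds (hψ.continuous.continuousAt.eventually_lt_const hcψ)] with y h1 h2 h3
    rw [hWin y h2]
    exact max_le h1.le h3.le
  have heq : uEnv Ω (W j) z = ψ z := hle.antisymm (hge z hz hzr)
  have hmax' : IsLocalMax (fun y => ψ y - φ y) z := by
    filter_upwards [hmax, hΩ.mem_nhds hz, hballev] with y hy hyΩ hyr
    have := hge y hyΩ hyr
    rw [heq] at hy
    linarith
  refine (hstrict z hzr _ heq fun i => ?_).trans
    (hmax'.trace_hess_le hψ.contDiffAt hφ.contDiffAt)
  exact ((lEnv_le (hU i) hz).trans (hUW i z)).trans (le_uEnv (hW i) hz)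

/-- A maximal subsolution below a supersolution is a supersolution. -/
theorem IsViscositySub.isViscositySuper_of_maximal [Fintype ι] [DecidableEq ι] (hΩ : IsOpen Ω)
    (hG : ∀ k, ContinuousOn (fun p : En n × (ι → ℝ) => G k p.1 p.2) (Ω ×ˢ univ))
    (hGm : IsCooperative Ω G) {U M : ι → En n → ℝ} (hUsub : IsViscositySub Ω G U)
    (hMsuper : IsViscositySuper Ω G M)
    (hU : ∀ k, ∀ x ∈ Ω, |U k x| ≤ B) (hM : ∀ k, ∀ x ∈ Ω, |M k x| ≤ B)
    (hUM : ∀ k, ∀ x ∈ Ω, U k x ≤ M k x)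
    (H : ∀ W : ι → En n → ℝ, IsViscositySub Ω G W → (∀ k, ∀ x ∈ Ω, U k x ≤ W k x) →
      (∀ k, ∀ x ∈ Ω, W k x ≤ M k x) → ∀ k, ∀ x ∈ Ω, W k x ≤ U k x) :
    IsViscositySuper Ω G U := by
  intro k x hx φ hφ hmin
  refine hmin.trace_hess_le_of_quadratic hφ fun ψ hψ hψx ε hε htouch => ?_
  by_contra! hlt
  have hUMenv : ∀ j, ∀ z ∈ Ω, lEnv Ω (U j) z ≤ lEnv Ω (M j) z := fun j z hz =>
    lEnv_mono (hU j) (hM j) hz (by filter_upwards [self_mem_nhdsWithin] with t ht using hUM j t ht)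
  rcases le_or_gt (lEnv Ω (M k) x) (ψ x) with hMψ | hMψ
  · have hloc : IsLocalMin (fun y => lEnv Ω (M k) y - ψ y) x := by
      filter_upwards [htouch, hΩ.mem_nhds hx] with y hy hyΩ
      have h1 := hUMenv k y hyΩ
      have h2 : 0 ≤ ε * dist y x ^ 2 := by positivity
      linarith
    have h1 := hMsuper k x hx ψ hψ hloc
    have h2 := hGm k x hx _ _ (fun j => hUMenv j x hx)
      ((hUMenv k x hx).antisymm (hMψ.trans hψx.le))
    linarith
  obtain ⟨η, hη, hbox⟩ := exists_pos_forall_lt (F := fun x r => -G k x r) hΩ hx (hG k).neg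
    (continuous_trace_hess hψ).neg (neg_lt_neg hlt)
  set γ := (lEnv Ω (M k) x - ψ x) / 3 with hγdef
  have hγ : 0 < γ := by simp only [hγdef]; linarith
  have hev1 : ∀ᶠ y in 𝓝 x, ∀ j, lEnv Ω (U j) x - η / 2 < lEnv Ω (U j) y :=
    eventually_all.2 fun j => eventually_lt_lEnv hΩ (hU j) hx (by linarith)
  have hev2 : ∀ᶠ y in 𝓝 x, |ψ y - ψ x| < min γ (η / 4) :=
    Metric.tendsto_nhds.1 hψ.continuous.continuousAt _ (by positivity)
  have hev3 : ∀ᶠ y in 𝓝 x, ψ x + 2 * γ < lEnv Ω (M k) y :=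
    eventually_lt_lEnv hΩ (hM k) hx (by simp only [hγdef]; linarith)
  obtain ⟨R, hR, hball⟩ :=
    Metric.eventually_nhds_iff.1 (htouch.and (hev1.and (hev2.and hev3)))
  set r := min R η with hrdef
  have hr : 0 < r := by positivity
  have hrR : r ≤ R := min_le_left _ _
  have hrη : r ≤ η := min_le_right _ _
  set δ := min (ε * (r / 2) ^ 2) (min γ (η / 4)) with hδdef
  have hδ : 0 < δ := by positivity
  have hδε : δ ≤ ε * (r / 2) ^ 2 := min_le_left _ _
  have hδγ : δ ≤ γ := (min_le_right _ _).trans (min_le_left _ _)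
  have hδη : δ ≤ η / 4 := (min_le_right _ _).trans (min_le_right _ _)
  have hψδ : ContDiff ℝ 2 fun y => ψ y + δ := hψ.add contDiff_const
  let W : ι → En n → ℝ := Function.update U k fun y =>
    if dist y x < r then max (U k y) (ψ y + δ) else U k y
  have hWj : ∀ j, j ≠ k → W j = U j := fun j hj => by simp [W, hj]
  have hWin : ∀ y, dist y x < r → W k y = max (U k y) (ψ y + δ) := fun y hy => by
    simp [W, hy]
  have hWout : ∀ y, r ≤ dist y x → W k y = U k y := fun y hy => by simp [W, hy.not_gt]
  have hUW : ∀ j, ∀ y ∈ Ω, U j y ≤ W j y := by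
    intro j y _
    by_cases hj : j = k
    · subst hj
      rcases lt_or_ge (dist y x) r with hy | hy
      · rw [hWin y hy]; exact le_max_left _ _
      · exact (hWout y hy).ge
    · rw [hWj j hj]
  have hWM : ∀ j, ∀ y ∈ Ω, W j y ≤ M j y := by
    intro j y hy
    by_cases hj : j = k
    · subst hj
      rcases lt_or_ge (dist y x) r with hyr | hyr
      · rw [hWin y hyr]
        obtain ⟨-, -, h2, h3⟩ := hball (hyr.trans_le hrR)
        have h4 := (abs_lt.1 (h2.trans_le (min_le_left _ _))).2
        have h5 := lEnv_le (hM j) hy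
        refine max_le (hUM j y hy) ?_
        linarith
      · exact (hWout y hyr).trans_le (hUM j y hy)
    · rw [hWj j hj]; exact hUM j y hy
  have hWB : ∀ j, ∀ y ∈ Ω, |W j y| ≤ B := fun j y hy => abs_le.2
    ⟨(abs_le.1 (hU j y hy)).1.trans (hUW j y hy), (hWM j y hy).trans (abs_le.1 (hM j y hy)).2⟩
  have hWsub : IsViscositySub Ω G W := by
    refine hUsub.bump hΩ hGm hU hWB hψδ hWj hWin hWout (fun y hy hy1 hy2 => ?_)
      (fun z hz s hsk hs => ?_)
    · obtain ⟨h1, -⟩ := hball (hy2.trans_le hrR)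
      have h2 := lEnv_le (hU k) hy
      have h3 : ε * (r / 2) ^ 2 ≤ ε * dist y x ^ 2 := by gcongr
      linarith
    · obtain ⟨-, h1, h2, -⟩ := hball (hz.trans_le hrR)
      obtain ⟨hzΩ, hbz⟩ := hbox z (hz.trans_le hrη)
      let t : ι → ℝ := Function.update (fun j => lEnv Ω (U j) x - η / 2) k (s k)
      have htk : t k = s k := by simp [t]
      have htj : ∀ j, j ≠ k → t j = lEnv Ω (U j) x - η / 2 := fun j hj => by simp [t, hj]
      have hmono := hGm k z hzΩ t s (fun j => by
        by_cases hj : j = k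
        · subst hj; exact htk.le
        · rw [htj j hj]; exact (h1 j).le.trans (hs j)) htk
      have hb : -(hess ψ z).trace < -G k z t := hbz t (fun j => by
        by_cases hj : j = k
        · subst hj
          have h3 := abs_lt.1 (h2.trans_le (min_le_right _ _))
          rw [htk, hsk, ← hψx, abs_lt]
          constructor <;> linarith
        · rw [htj j hj, sub_sub_cancel_left, abs_neg, abs_of_pos (by positivity)]
          linarith)
      rw [trace_hess_add_const hψ.contDiffAt]
      linarith
  have hWU := H W hWsub hUW hWM k
  have h1 := frequently_lt_of_lEnv_lt (hU k) hx
    (show lEnv Ω (U k) x < ψ x + δ / 2 by linarith)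
  have h2 : ∀ᶠ y in 𝓝[Ω] x, ψ x - δ / 2 < ψ y ∧ dist y x < r := nhdsWithin_le_nhds
    ((hψ.continuous.continuousAt.eventually_const_lt (by linarith)).and
      (Metric.ball_mem_nhds x hr))
  obtain ⟨y, hy1, ⟨hy2, hy3⟩, hyΩ⟩ := (h1.and_eventually (h2.and self_mem_nhdsWithin)).exists
  have h3 := hWU y hyΩ
  rw [hWin y hy3] at h3
  have h4 := (le_max_right _ _).trans h3
  linarith

/-- **Perron's method**: between an ordered pair of a bounded subsolution and a bounded
supersolution of a cooperative system lies a (possibly discontinuous) viscosity solution. -/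
theorem exists_isViscositySub_isViscositySuper [Fintype ι] [DecidableEq ι] (hΩ : IsOpen Ω)
    (hG : ∀ k, ContinuousOn (fun p : En n × (ι → ℝ) => G k p.1 p.2) (Ω ×ˢ univ))
    (hGm : IsCooperative Ω G) {L M : ι → En n → ℝ} (hLsub : IsViscositySub Ω G L)
    (hMsuper : IsViscositySuper Ω G M)
    (hL : ∀ k, ∀ x ∈ Ω, |L k x| ≤ B) (hM : ∀ k, ∀ x ∈ Ω, |M k x| ≤ B)
    (hLM : ∀ k, ∀ x ∈ Ω, L k x ≤ M k x) :
    ∃ U : ι → En n → ℝ, IsViscositySub Ω G U ∧ IsViscositySuper Ω G U ∧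
      (∀ k, ∀ x ∈ Ω, L k x ≤ U k x) ∧ ∀ k, ∀ x ∈ Ω, U k x ≤ M k x := by
  let S : Set (ι → En n → ℝ) := {W | IsViscositySub Ω G W ∧ (∀ k, ∀ x ∈ Ω, L k x ≤ W k x) ∧
    ∀ k, ∀ x ∈ Ω, W k x ≤ M k x}
  have hLS : L ∈ S := ⟨hLsub, fun _ _ _ => le_rfl, hLM⟩
  let U : ι → En n → ℝ := fun k x => sSup ((fun W : ι → En n → ℝ => W k x) '' S)
  have hne : ∀ k x, ((fun W : ι → En n → ℝ => W k x) '' S).Nonempty := fun k x =>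
    ⟨_, L, hLS, rfl⟩
  have hupper : ∀ k, ∀ x ∈ Ω, M k x ∈ upperBounds ((fun W : ι → En n → ℝ => W k x) '' S) := by
    rintro k x hx _ ⟨W, hW, rfl⟩
    exact hW.2.2 k x hx
  have hle : ∀ W ∈ S, ∀ k, ∀ x ∈ Ω, W k x ≤ U k x := fun W hW k x hx =>
    le_csSup ⟨_, hupper k x hx⟩ ⟨W, hW, rfl⟩
  have hUM : ∀ k, ∀ x ∈ Ω, U k x ≤ M k x := fun k x hx => csSup_le (hne k x) (hupper k x hx)
  have hbdd : ∀ W : ι → En n → ℝ, (∀ k, ∀ x ∈ Ω, L k x ≤ W k x) →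
      (∀ k, ∀ x ∈ Ω, W k x ≤ M k x) → ∀ k, ∀ x ∈ Ω, |W k x| ≤ B := fun W h1 h2 k x hx => abs_le.2
    ⟨(abs_le.1 (hL k x hx)).1.trans (h1 k x hx), (h2 k x hx).trans (abs_le.1 (hM k x hx)).2⟩
  have hU := hbdd U (hle L hLS) hUM
  have hUsub : IsViscositySub Ω G U := by
    refine isViscositySub_of_forall_exists hΩ hG hGm hU fun k x hx c hc => ?_
    obtain ⟨_, ⟨W, hW, rfl⟩, hcW⟩ := exists_lt_of_lt_csSup (hne k x) hc
    exact ⟨W, hW.1, hbdd W hW.2.1 hW.2.2, hle W hW, hcW⟩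
  refine ⟨U, hUsub, ?_, hle L hLS, hUM⟩
  exact hUsub.isViscositySuper_of_maximal hΩ hG hGm hMsuper hU hM hUM fun W hW hUW hWM =>
    hle W ⟨hW, fun k x hx => (hle L hLS k x hx).trans (hUW k x hx), hWM⟩

end Perron

section Classical

variable {n : ℕ} {ι : Type*} {Ω : Set (En n)} {G : ι → En n → (ι → ℝ) → ℝ}

theorem isViscositySub_of_contDiffOn (hΩ : IsOpen Ω) {U : ι → En n → ℝ}
    (hU : ∀ k, ContDiffOn ℝ 2 (U k) Ω)
    (h : ∀ k, ∀ x ∈ Ω, G k x (fun j => U j x) ≤ (hess (U k) x).trace) :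
    IsViscositySub Ω G U := by
  intro k x hx φ hφ hmax
  have hc : ∀ j, ∀ y ∈ Ω, uEnv Ω (U j) y = U j y := fun j y hy =>
    uEnv_eq_of_continuousAt hy ((hU j).continuousOn.continuousAt (hΩ.mem_nhds hy))
  simp only [fun j => hc j x hx]
  refine (h k x hx).trans (IsLocalMax.trace_hess_le ?_ ((hU k).contDiffAt (hΩ.mem_nhds hx))
    hφ.contDiffAt)
  filter_upwards [hmax, hΩ.mem_nhds hx] with y hy hyΩ
  rwa [hc k y hyΩ, hc k x hx] at hy

theorem isViscositySuper_of_contDiffOn (hΩ : IsOpen Ω) {U : ι → En n → ℝ}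
    (hU : ∀ k, ContDiffOn ℝ 2 (U k) Ω)
    (h : ∀ k, ∀ x ∈ Ω, (hess (U k) x).trace ≤ G k x (fun j => U j x)) :
    IsViscositySuper Ω G U := by
  intro k x hx φ hφ hmin
  have hc : ∀ j, ∀ y ∈ Ω, lEnv Ω (U j) y = U j y := fun j y hy =>
    lEnv_eq_of_continuousAt hy ((hU j).continuousOn.continuousAt (hΩ.mem_nhds hy))
  simp only [fun j => hc j x hx]
  refine (IsLocalMax.trace_hess_le ?_ hφ.contDiffAt
    ((hU k).contDiffAt (hΩ.mem_nhds hx))).trans (h k x hx)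
  filter_upwards [hmin, hΩ.mem_nhds hx] with y hy hyΩ
  rw [hc k y hyΩ, hc k x hx] at hy
  linarith

/-- Weak maximum principle. -/
theorem nonpos_of_trace_hess_pos (hΩ : IsOpen Ω) (hΩb : IsBounded Ω) {w : En n → ℝ}
    (hw : ContDiffOn ℝ 2 w Ω) (hwc : ContinuousOn w (closure Ω))
    (hbd : ∀ x ∈ frontier Ω, w x ≤ 0) (h : ∀ x ∈ Ω, 0 < w x → 0 < (hess w x).trace) :
    ∀ x ∈ Ω, w x ≤ 0 := by
  intro x hx
  obtain ⟨z, hz, hmax⟩ := hΩb.isCompact_closure.exists_isMaxOn ⟨x, subset_closure hx⟩ hwc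
  refine (hmax (subset_closure hx)).trans ?_
  by_cases hzΩ : z ∈ Ω
  · by_contra! hpos
    exact (h z hzΩ hpos).not_ge ((hmax.isLocalMax (mem_of_superset (hΩ.mem_nhds hzΩ)
      subset_closure)).trace_hess_nonpos (hw.contDiffAt (hΩ.mem_nhds hzΩ)))
  · exact hbd z (by rw [hΩ.frontier_eq]; exact ⟨hz, hzΩ⟩)

theorem TouchAbove.isLocalMax (hΩ : IsOpen Ω) {φ h : En n → ℝ} {x : En n} (hx : x ∈ Ω)
    (ht : TouchAbove Ω φ h x) : IsLocalMax (fun y => h y - φ y) x := by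
  obtain ⟨heq, N, hN, hxN, hlt⟩ := ht
  filter_upwards [hN.mem_nhds hxN, hΩ.mem_nhds hx] with y hyN hyΩ
  by_cases hy : y = x
  · rw [hy]
  · have := hlt y ⟨⟨hyN, hyΩ⟩, hy⟩
    linarith

theorem TouchBelow.isLocalMin (hΩ : IsOpen Ω) {φ h : En n → ℝ} {x : En n} (hx : x ∈ Ω)
    (ht : TouchBelow Ω φ h x) : IsLocalMin (fun y => h y - φ y) x := by
  obtain ⟨heq, N, hN, hxN, hlt⟩ := ht
  filter_upwards [hN.mem_nhds hxN, hΩ.mem_nhds hx] with y hyN hyΩ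
  by_cases hy : y = x
  · rw [hy]
  · have := hlt y ⟨⟨hyN, hyΩ⟩, hy⟩
    linarith

end Classical

section Competitive

variable {n : ℕ} {Ω : Set (En n)} {lam al be : ℝ} {f g : En n → ℝ}

/-- The competitive system, written as a cooperative one for the pair `(u, -v)`. -/
def compOp (lam al be : ℝ) (f g : En n → ℝ) : Fin 2 → En n → (Fin 2 → ℝ) → ℝ :=
  ![fun x r => lam * r 0 + al * max (r 0) (-r 1) - f x,
    fun x r => lam * r 1 - be * max (r 0) (-r 1) + g x]

theorem compOp_continuousOn (hf : ContinuousOn f Ω) (hg : ContinuousOn g Ω) (k : Fin 2) :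
    ContinuousOn (fun p : En n × (Fin 2 → ℝ) => compOp lam al be f g k p.1 p.2)
      (Ω ×ˢ Set.univ) := by
  have hf' : ContinuousOn (fun p : En n × (Fin 2 → ℝ) => f p.1) (Ω ×ˢ Set.univ) :=
    hf.comp continuousOn_fst fun p hp => hp.1
  have hg' : ContinuousOn (fun p : En n × (Fin 2 → ℝ) => g p.1) (Ω ×ˢ Set.univ) :=
    hg.comp continuousOn_fst fun p hp => hp.1
  have h0 (c : ℝ) : Continuous fun p : En n × (Fin 2 → ℝ) => c * max (p.2 0) (-p.2 1) := by
    fun_prop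
  have h1 (i : Fin 2) : Continuous fun p : En n × (Fin 2 → ℝ) => lam * p.2 i := by fun_prop
  fin_cases k
  · exact ((h1 0).add (h0 al)).continuousOn.sub hf'
  · exact ((h1 1).sub (h0 be)).continuousOn.add hg'

theorem compOp_isCooperative (hal : 0 ≤ al) (hbe : 0 ≤ be) :
    IsCooperative Ω (compOp lam al be f g) := by
  intro k x _ r s hrs hk
  have h0 := hrs 0
  have h1 := hrs 1
  fin_cases k
  · simp only [compOp, Fin.zero_eta, Matrix.cons_val_zero] at hk ⊢
    have : max (s 0) (-s 1) ≤ max (r 0) (-r 1) := max_le_max hk.ge (neg_le_neg h1)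
    have := mul_le_mul_of_nonneg_left this hal
    rw [hk] at *
    linarith
  · simp only [compOp, Fin.mk_one, Matrix.cons_val_one, Matrix.cons_val_zero] at hk ⊢
    have : max (r 0) (-r 1) ≤ max (s 0) (-s 1) := max_le_max h0 (neg_le_neg hk.ge)
    have := mul_le_mul_of_nonneg_left this hbe
    rw [hk] at *
    linarith

theorem uEnv_neg (Ω : Set (En n)) (h : En n → ℝ) (x : En n) : uEnv Ω (-h) x = -lEnv Ω h x := by
  rw [lEnv_eq_neg_uEnv, neg_neg]

theorem lEnv_neg (Ω : Set (En n)) (h : En n → ℝ) (x : En n) : lEnv Ω (-h) x = -uEnv Ω h x := by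
  rw [lEnv_eq_neg_uEnv, neg_neg]

theorem compSuperSub_of_isViscositySuper (hΩ : IsOpen Ω) {B : ℝ} {U : Fin 2 → En n → ℝ}
    (hB : ∀ k, ∀ x ∈ Ω, |U k x| ≤ B) (hU : IsViscositySuper Ω (compOp lam al be f g) U) :
    CompSuperSub Ω lam al be f g (U 0) (-U 1) := by
  refine ⟨⟨B, fun x hx => ⟨hB 0 x hx, by simpa using hB 1 x hx⟩⟩,
    fun x hx φ hφ ht => ?_, fun x hx φ hφ ht => ?_⟩
  · have := hU 0 x hx φ hφ (ht.isLocalMin hΩ hx)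
    simp only [compOp, Matrix.cons_val_zero] at this
    rw [uEnv_neg]
    linarith
  · have hloc : IsLocalMin (fun y => lEnv Ω (U 1) y - (-φ) y) x := by
      filter_upwards [ht.isLocalMax hΩ hx] with y hy
      simp only [uEnv_neg, Pi.neg_apply] at hy ⊢
      linarith
    have := hU 1 x hx (-φ) hφ.neg hloc
    simp only [compOp, Matrix.cons_val_zero, Matrix.cons_val_one, trace_hess_neg] at this
    rw [uEnv_neg]
    linarith

theorem compSubSuper_of_isViscositySub (hΩ : IsOpen Ω) {B : ℝ} {U : Fin 2 → En n → ℝ}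
    (hB : ∀ k, ∀ x ∈ Ω, |U k x| ≤ B) (hU : IsViscositySub Ω (compOp lam al be f g) U) :
    CompSubSuper Ω lam al be f g (U 0) (-U 1) := by
  refine ⟨⟨B, fun x hx => ⟨hB 0 x hx, by simpa using hB 1 x hx⟩⟩,
    fun x hx φ hφ ht => ?_, fun x hx φ hφ ht => ?_⟩
  · have := hU 0 x hx φ hφ (ht.isLocalMax hΩ hx)
    simp only [compOp, Matrix.cons_val_zero] at this
    rw [lEnv_neg]
    linarith
  · have hloc : IsLocalMax (fun y => uEnv Ω (U 1) y - (-φ) y) x := by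
      filter_upwards [ht.isLocalMin hΩ hx] with y hy
      simp only [lEnv_neg, Pi.neg_apply] at hy ⊢
      linarith
    have := hU 1 x hx (-φ) hφ.neg hloc
    simp only [compOp, Matrix.cons_val_zero, Matrix.cons_val_one, trace_hess_neg] at this
    rw [lEnv_neg]
    linarith

end Competitive

/-- Existence and comparison for the competitive system: given the four
auxiliary functions ū, v̲, v̄, u̲ (in C²(Ω) ∩ C(cl Ω), vanishing on ∂Ω, solving the
indicated equations), there exists a solution (u, v) of the competitive system, i.e. a
pair that is both a super-sub and a sub-super solution, with u̲ ≤ u ≤ ū and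
v̲ ≤ v ≤ v̄ in Ω. -/
theorem competitive_existence {n : ℕ}
    (Ω : Set (En n)) (hΩo : IsOpen Ω) (hΩb : IsBounded Ω)
    (lam al be : ℝ) (hlam : 0 < lam) (hal : 0 < al) (hbe : 0 < be)
    (f g : En n → ℝ)
    (hf : ContDiffOn ℝ (⊤ : ℕ∞) f (closure Ω)) (hg : ContDiffOn ℝ (⊤ : ℕ∞) g (closure Ω))
    (hf0 : ∀ x ∈ closure Ω, 0 ≤ f x) (hg0 : ∀ x ∈ closure Ω, 0 ≤ g x)
    (ubar vbar ulow vlow : En n → ℝ)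
    (hubar : ContDiffOn ℝ 2 ubar Ω) (hubarc : ContinuousOn ubar (closure Ω))
    (hvbar : ContDiffOn ℝ 2 vbar Ω) (hvbarc : ContinuousOn vbar (closure Ω))
    (hulow : ContDiffOn ℝ 2 ulow Ω) (hulowc : ContinuousOn ulow (closure Ω))
    (hvlow : ContDiffOn ℝ 2 vlow Ω) (hvlowc : ContinuousOn vlow (closure Ω))
    (hubar_bd : ∀ x ∈ frontier Ω, ubar x = 0)
    (hvbar_bd : ∀ x ∈ frontier Ω, vbar x = 0)
    (hulow_bd : ∀ x ∈ frontier Ω, ulow x = 0)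
    (hvlow_bd : ∀ x ∈ frontier Ω, vlow x = 0)
    (hubar_eq : ∀ x ∈ Ω, -(hess ubar x).trace + lam * ubar x - f x = 0)
    (hvlow_eq : ∀ x ∈ Ω,
      -(hess vlow x).trace + lam * vlow x + be * max (ubar x) (vlow x) - g x = 0)
    (hvbar_eq : ∀ x ∈ Ω, -(hess vbar x).trace + lam * vbar x - g x = 0)
    (hulow_eq : ∀ x ∈ Ω,
      -(hess ulow x).trace + lam * ulow x + al * max (ulow x) (vbar x) - f x = 0) :
    ∃ u v : En n → ℝ,
      CompSuperSub Ω lam al be f g u v ∧ CompSubSuper Ω lam al be f g u v ∧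
      (∀ x ∈ Ω, ulow x ≤ u x ∧ u x ≤ ubar x ∧ vlow x ≤ v x ∧ v x ≤ vbar x) := by
  have hmem : ∀ x ∈ Ω, x ∈ closure Ω := fun x hx => subset_closure hx
  have hat : ∀ {w : En n → ℝ}, ContDiffOn ℝ 2 w Ω → ∀ x ∈ Ω, ContDiffAt ℝ 2 w x :=
    fun hw x hx => hw.contDiffAt (hΩo.mem_nhds hx)
  have hvbar0 : ∀ x ∈ Ω, 0 ≤ vbar x := fun x hx => neg_nonpos.1 <|
    nonpos_of_trace_hess_pos hΩo hΩb (w := -vbar) hvbar.neg hvbarc.neg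
      (fun y hy => by simp [hvbar_bd y hy]) (fun y hy hpos => by
        have h1 := hvbar_eq y hy
        have h2 := hg0 y (hmem y hy)
        have h3 := mul_pos hlam hpos
        simp only [Pi.neg_apply] at h3
        rw [trace_hess_neg]
        linarith) x hx
  have hubar0 : ∀ x ∈ Ω, 0 ≤ ubar x := fun x hx => neg_nonpos.1 <|
    nonpos_of_trace_hess_pos hΩo hΩb (w := -ubar) hubar.neg hubarc.neg
      (fun y hy => by simp [hubar_bd y hy]) (fun y hy hpos => by
        have h1 := hubar_eq y hy
        have h2 := hf0 y (hmem y hy)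
        have h3 := mul_pos hlam hpos
        simp only [Pi.neg_apply] at h3
        rw [trace_hess_neg]
        linarith) x hx
  have hu : ∀ x ∈ Ω, ulow x ≤ ubar x := fun x hx => sub_nonpos.1 <|
    nonpos_of_trace_hess_pos hΩo hΩb (w := ulow - ubar) (hulow.sub hubar) (hulowc.sub hubarc)
      (fun y hy => by simp [hubar_bd y hy, hulow_bd y hy]) (fun y hy hpos => by
        have h1 := hubar_eq y hy
        have h2 := hulow_eq y hy
        have h3 := mul_pos hlam hpos
        have h4 : 0 ≤ al * max (ulow y) (vbar y) :=
          mul_nonneg hal.le ((hvbar0 y hy).trans (le_max_right _ _))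
        simp only [Pi.sub_apply] at h3
        rw [trace_hess_sub (hat hulow y hy) (hat hubar y hy)]
        linarith) x hx
  have hv : ∀ x ∈ Ω, vlow x ≤ vbar x := fun x hx => sub_nonpos.1 <|
    nonpos_of_trace_hess_pos hΩo hΩb (w := vlow - vbar) (hvlow.sub hvbar) (hvlowc.sub hvbarc)
      (fun y hy => by simp [hvbar_bd y hy, hvlow_bd y hy]) (fun y hy hpos => by
        have h1 := hvbar_eq y hy
        have h2 := hvlow_eq y hy
        have h3 := mul_pos hlam hpos
        have h4 : 0 ≤ be * max (ubar y) (vlow y) :=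
          mul_nonneg hbe.le ((hubar0 y hy).trans (le_max_left _ _))
        simp only [Pi.sub_apply] at h3
        rw [trace_hess_sub (hat hvlow y hy) (hat hvbar y hy)]
        linarith) x hx
  obtain ⟨B₁, hB₁⟩ := hΩb.isCompact_closure.exists_bound_of_continuousOn hulowc
  obtain ⟨B₂, hB₂⟩ := hΩb.isCompact_closure.exists_bound_of_continuousOn hubarc
  obtain ⟨B₃, hB₃⟩ := hΩb.isCompact_closure.exists_bound_of_continuousOn hvlowc
  obtain ⟨B₄, hB₄⟩ := hΩb.isCompact_closure.exists_bound_of_continuousOn hvbarc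
  simp only [Real.norm_eq_abs] at hB₁ hB₂ hB₃ hB₄
  let B := max (max B₁ B₂) (max B₃ B₄)
  have hL : ∀ k, ∀ x ∈ Ω, |(![ulow, -vbar] : Fin 2 → En n → ℝ) k x| ≤ B := by
    intro k x hx
    fin_cases k
    · exact (hB₁ x (hmem x hx)).trans ((le_max_left _ _).trans (le_max_left _ _))
    · exact (abs_neg _).trans_le
        ((hB₄ x (hmem x hx)).trans ((le_max_right _ _).trans (le_max_right _ _)))
  have hM : ∀ k, ∀ x ∈ Ω, |(![ubar, -vlow] : Fin 2 → En n → ℝ) k x| ≤ B := by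
    intro k x hx
    fin_cases k
    · exact (hB₂ x (hmem x hx)).trans ((le_max_right _ _).trans (le_max_left _ _))
    · exact (abs_neg _).trans_le
        ((hB₃ x (hmem x hx)).trans ((le_max_left _ _).trans (le_max_right _ _)))
  have hLM : ∀ k, ∀ x ∈ Ω, (![ulow, -vbar] : Fin 2 → En n → ℝ) k x ≤
      (![ubar, -vlow] : Fin 2 → En n → ℝ) k x := by
    intro k x hx
    fin_cases k
    · exact hu x hx
    · exact neg_le_neg (hv x hx)
  have hLsub : IsViscositySub Ω (compOp lam al be f g) ![ulow, -vbar] := by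
    refine isViscositySub_of_contDiffOn hΩo (fun k => ?_) fun k x hx => ?_
    · fin_cases k
      exacts [hulow, hvbar.neg]
    · fin_cases k
      · have := hulow_eq x hx
        simp [compOp]
        linarith
      · have := hvbar_eq x hx
        have h4 : 0 ≤ be * max (ulow x) (vbar x) :=
          mul_nonneg hbe.le ((hvbar0 x hx).trans (le_max_right _ _))
        simp [compOp, trace_hess_neg]
        linarith
  have hMsuper : IsViscositySuper Ω (compOp lam al be f g) ![ubar, -vlow] := by
    refine isViscositySuper_of_contDiffOn hΩo (fun k => ?_) fun k x hx => ?_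
    · fin_cases k
      exacts [hubar, hvlow.neg]
    · fin_cases k
      · have := hubar_eq x hx
        have h4 : 0 ≤ al * max (ubar x) (vlow x) :=
          mul_nonneg hal.le ((hubar0 x hx).trans (le_max_left _ _))
        simp [compOp]
        linarith
      · have := hvlow_eq x hx
        simp [compOp, trace_hess_neg]
        linarith
  obtain ⟨U, hUsub, hUsuper, hLU, hUM⟩ := exists_isViscositySub_isViscositySuper hΩo
    (compOp_continuousOn (hf.continuousOn.mono subset_closure)
      (hg.continuousOn.mono subset_closure))
    (compOp_isCooperative hal.le hbe.le) hLsub hMsuper hL hM hLM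
  have hU : ∀ k, ∀ x ∈ Ω, |U k x| ≤ B := fun k x hx => abs_le.2
    ⟨(abs_le.1 (hL k x hx)).1.trans (hLU k x hx), (hUM k x hx).trans (abs_le.1 (hM k x hx)).2⟩
  exact ⟨U 0, -U 1, compSuperSub_of_isViscositySuper hΩo hU hUsuper,
    compSubSuper_of_isViscositySub hΩo hU hUsub, fun x hx =>
      ⟨hLU 0 x hx, hUM 0 x hx, le_neg_of_le_neg (hUM 1 x hx), neg_le_of_neg_le (hLU 1 x hx)⟩⟩
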